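/- Let R = 𝔽₂[X]/(X²) and let M₁, …, M_k (with k ≥ 1) be finitely generated R-modules. Equip the iterated tensor product M = M₁ ⊗_{𝔽₂} ⋯ ⊗_{𝔽₂} M_k (formed over 𝔽₂ via restriction of scalars) with the R-module structure in which X acts by X·(m₁ ⊗ ⋯ ⊗ m_k) = Σ_{i=1}^{k} m₁ ⊗ ⋯ ⊗ m_{i−1} ⊗ (X·m_i) ⊗ m_{i+1} ⊗ ⋯ ⊗ m_k. Then M is a free R-module if and only if at least one of the modules M_i is a free R-module. -/

import Mathlib

open scoped DualNumber TensorProduct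

namespace DualNumber

variable {K N : Type*} [Field K] [AddCommGroup N] [Module K[ε] N] [Module K N]
  [IsScalarTower K K[ε] N]

theorem smul_eq_fst_smul_add_eps_smul (r : K[ε]) (x : N) :
    r • x = r.fst • x + (ε : K[ε]) • r.snd • x := by
  have h : r = algebraMap K K[ε] r.fst + ε * algebraMap K K[ε] r.snd := by
    ext <;> simp [TrivSqZeroExt.algebraMap_eq_inl]
  conv_lhs => rw [h]
  rw [add_smul, mul_smul, algebraMap_smul, algebraMap_smul]

/-- Multiplication by `ε` on a free module over the dual numbers is a contractible differential. -/
theorem exists_contraction_of_free [Module.Free K[ε] N] :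
    ∃ h : N →ₗ[K] N, ∀ x, (ε : K[ε]) • h x + h ((ε : K[ε]) • x) = x := by
  let b := Module.Free.chooseBasis K[ε] N
  let s : K[ε] →ₗ[K] K[ε] := Algebra.linearMap K K[ε] ∘ₗ TrivSqZeroExt.sndHom K K
  have hs (r : K[ε]) : ε * s r + s (ε * r) = r := by
    ext <;> simp [s, TrivSqZeroExt.algebraMap_eq_inl]
  refine ⟨(b.repr.symm.restrictScalars K).toLinearMap ∘ₗ Finsupp.mapRange.linearMap s ∘ₗ
    (b.repr.restrictScalars K).toLinearMap, fun x ↦ b.repr.injective ?_⟩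
  ext1 i
  simpa using hs (b.repr x i)

/-- A module over the dual numbers on which the kernel of `ε` is contained in its range is free. -/
theorem free_of_exact (hN : ∀ x : N, (ε : K[ε]) • x = 0 → ∃ y : N, (ε : K[ε]) • y = x) :
    Module.Free K[ε] N := by
  let d : N →ₗ[K] N := Algebra.lsmul K K N (ε : K[ε])
  have hdd (x : N) : (ε : K[ε]) • (ε : K[ε]) • x = 0 := by
    rw [← mul_smul, DualNumber.eps_mul_eps, zero_smul]
  obtain ⟨C, hC⟩ := Submodule.exists_isCompl (LinearMap.ker d)
  let c := Module.Free.chooseBasis K C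
  let v : Module.Free.ChooseBasisIndex K C → N := fun i ↦ c i
  have hv (l) : Finsupp.linearCombination K v l = (Finsupp.linearCombination K c l : C) :=
    (Finsupp.apply_linearCombination K C.subtype c l).symm
  have hzero (l) (hl : (ε : K[ε]) • Finsupp.linearCombination K v l = 0) : l = 0 := by
    have hmem : Finsupp.linearCombination K v l ∈ LinearMap.ker d := hl
    have h0 := Submodule.disjoint_def.1 hC.disjoint _ hmem (by rw [hv]; exact Subtype.prop _)
    rw [hv, Submodule.coe_eq_zero] at h0
    exact linearIndependent_iff.1 c.linearIndependent l h0
  let π₀ : (Module.Free.ChooseBasisIndex K C →₀ K[ε]) →ₗ[K] _ :=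
    Finsupp.mapRange.linearMap (TrivSqZeroExt.fstHom K K K).toLinearMap
  let π₁ : (Module.Free.ChooseBasisIndex K C →₀ K[ε]) →ₗ[K] _ :=
    Finsupp.mapRange.linearMap (TrivSqZeroExt.sndHom K K)
  have hsplit (l : Module.Free.ChooseBasisIndex K C →₀ K[ε]) :
      Finsupp.linearCombination K[ε] v l =
        Finsupp.linearCombination K v (π₀ l) + (ε : K[ε]) • Finsupp.linearCombination K v (π₁ l) := by
    induction l using Finsupp.induction_linear with
    | zero => simp
    | add f g hf hg => simp only [map_add, hf, hg, smul_add]; abel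
    | single i r => simpa [π₀, π₁] using smul_eq_fst_smul_add_eps_smul r (v i)
  have hli : LinearIndependent K[ε] v := by
    rw [linearIndependent_iff]
    intro l hl
    rw [hsplit] at hl
    have h1 := hzero (π₀ l) (by simpa [hdd] using congrArg ((ε : K[ε]) • ·) hl)
    rw [h1, map_zero, zero_add] at hl
    have h2 := hzero (π₁ l) hl
    ext i
    · simpa [π₀] using DFunLike.congr_fun h1 i
    · simpa [π₁] using DFunLike.congr_fun h2 i
  have hCspan : ∀ x ∈ C, x ∈ Submodule.span K[ε] (Set.range v) := by
    intro x hx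
    have : Finsupp.linearCombination K v (c.repr ⟨x, hx⟩) = x := by
      rw [hv, c.linearCombination_repr]
    rw [← this]
    exact Submodule.span_le_restrictScalars K K[ε] _
      (Finsupp.mem_span_range_iff_exists_finsupp.2 ⟨_, rfl⟩)
  have hspan : ⊤ ≤ Submodule.span K[ε] (Set.range v) := by
    have hdec (x : N) : ∃ y z, (ε : K[ε]) • y = 0 ∧ z ∈ C ∧ y + z = x := by
      obtain ⟨y, hy, z, hz, h⟩ := Submodule.mem_sup.1 (hC.sup_eq_top ▸ Submodule.mem_top (x := x))
      exact ⟨y, z, hy, hz, h⟩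
    rintro x -
    obtain ⟨y, z, hy, hz, rfl⟩ := hdec x
    obtain ⟨w, rfl⟩ := hN y hy
    obtain ⟨p, q, hp, hq, rfl⟩ := hdec w
    rw [smul_add, hp, zero_add]
    exact add_mem (Submodule.smul_mem _ _ (hCspan q hq)) (hCspan z hz)
  exact Module.Free.of_basis (Module.Basis.mk hli hspan)

/-- Over the dual numbers, a vector annihilated by `ε` but not divisible by `ε` is detected by a
functional vanishing on all multiples of `ε`. -/
theorem exists_functional_of_not_free (hN : ¬ Module.Free K[ε] N) :
    ∃ (x : N) (f : N →ₗ[K] K), (ε : K[ε]) • x = 0 ∧ f x = 1 ∧ ∀ y, f ((ε : K[ε]) • y) = 0 := by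
  obtain ⟨x, hx, hx'⟩ : ∃ x : N, (ε : K[ε]) • x = 0 ∧ ∀ y : N, (ε : K[ε]) • y ≠ x := by
    contrapose! hN
    exact free_of_exact hN
  obtain ⟨f, hf, hf'⟩ := Submodule.exists_le_ker_of_notMem
    (p := LinearMap.range (Algebra.lsmul K K N (ε : K[ε]))) (v := x) (fun ⟨y, hy⟩ ↦ hx' y hy)
  refine ⟨x, (f x)⁻¹ • f, hx, by simp [hf], fun y ↦ ?_⟩
  have : f ((ε : K[ε]) • y) = 0 := hf' ⟨y, rfl⟩
  simp [this]

end DualNumber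

/-- `𝔽₂ = ℤ/2`, the field with two elements. -/
abbrev F2 : Type := ZMod 2

/-- `R = 𝔽₂[X]/(X²)`, realized as the ring of dual numbers over `𝔽₂`
(the class of `X` corresponds to `ε`). -/
abbrev R : Type := DualNumber F2

/-- Let `R = 𝔽₂[X]/(X²)` and let `M₁, …, M_k` (`k ≥ 1`) be finitely generated
`R`-modules.  Equip `M = M₁ ⊗[𝔽₂] ⋯ ⊗[𝔽₂] M_k` (formed over `𝔽₂` via restriction of scalars)
with the `R`-module structure in which `X` acts by the Leibniz rule
`X • (m₁ ⊗ ⋯ ⊗ m_k) = Σᵢ m₁ ⊗ ⋯ ⊗ (X • mᵢ) ⊗ ⋯ ⊗ m_k`.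
Then `M` is a free `R`-module iff at least one `Mᵢ` is a free `R`-module. -/
theorem piTensor_free_iff_exists_factor_free
    (k : ℕ) (hk : 1 ≤ k) (M : Fin k → Type*)
    [∀ i, AddCommGroup (M i)] [∀ i, Module R (M i)] [∀ i, Module.Finite R (M i)]
    -- the `𝔽₂`-module structures obtained by restriction of scalars along `𝔽₂ → R`
    [∀ i, Module F2 (M i)] [∀ i, IsScalarTower F2 R (M i)]
    -- the `R`-module structure on `⨂[𝔽₂] i, M i`, compatible with its `𝔽₂`-structure, ...
    [Module R (⨂[F2] i, M i)] [IsScalarTower F2 R (⨂[F2] i, M i)]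
    -- ... in which `X` acts by the Leibniz rule:
    (hLeibniz : ∀ m : (i : Fin k) → M i,
      (ε : R) • (⨂ₜ[F2] i, m i) =
        ∑ i : Fin k, ⨂ₜ[F2] j, Function.update m i ((ε : R) • m i) j) :
    Module.Free R (⨂[F2] i, M i) ↔ (∃ i, Module.Free R (M i)) := by
  constructor
  · intro hfree
    by_contra! hM
    choose x f hx hfx hf using fun i ↦ DualNumber.exists_functional_of_not_free (hM i)
    let F : (⨂[F2] i, M i) →ₗ[F2] F2 :=
      PiTensorProduct.lift ((MultilinearMap.mkPiRing F2 (Fin k) 1).compLinearMap f)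
    have hF (m : ∀ i, M i) : F (⨂ₜ[F2] i, m i) = ∏ i, f i (m i) := by simp [F]
    have hFε : F ∘ₗ Algebra.lsmul F2 F2 _ (ε : R) = 0 := by
      ext m
      have : F ((ε : R) • ⨂ₜ[F2] i, m i) = 0 := by
        rw [hLeibniz, map_sum]
        refine Finset.sum_eq_zero fun i _ ↦ ?_
        rw [hF]
        exact Finset.prod_eq_zero (Finset.mem_univ i) (by simp [hf])
      simpa using this
    obtain ⟨h, hh⟩ := DualNumber.exists_contraction_of_free (K := F2) (N := ⨂[F2] i, M i)
    have hεx : (ε : R) • (⨂ₜ[F2] i, x i) = 0 := by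
      rw [hLeibniz]
      refine Finset.sum_eq_zero fun i _ ↦ ?_
      rw [hx]
      exact (PiTensorProduct.tprod F2).map_update_zero x i
    have key := congrArg F (hh (⨂ₜ[F2] i, x i))
    rw [hεx, map_zero, add_zero, hF] at key
    have h0 : F ((ε : R) • h (⨂ₜ[F2] i, x i)) = 0 := LinearMap.congr_fun hFε _
    simp [h0, hfx] at key
  · rintro ⟨i, hi⟩
    obtain ⟨h, hh⟩ := DualNumber.exists_contraction_of_free (K := F2) (N := M i)
    let H : (⨂[F2] i, M i) →ₗ[F2] (⨂[F2] i, M i) :=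
      PiTensorProduct.map (Function.update (fun _ ↦ LinearMap.id) i h)
    have hH (m : ∀ j, M j) : H (⨂ₜ[F2] j, m j) =
        PiTensorProduct.tprod F2 (Function.update m i (h (m i))) := by
      simp only [H, PiTensorProduct.map_tprod]
      congr 1
      ext j
      obtain rfl | hj := eq_or_ne j i <;> simp [*]
    have hcontr : Algebra.lsmul F2 F2 _ (ε : R) ∘ₗ H + H ∘ₗ Algebra.lsmul F2 F2 _ (ε : R) =
        LinearMap.id := by
      ext m
      have : (ε : R) • H (⨂ₜ[F2] j, m j) + H ((ε : R) • ⨂ₜ[F2] j, m j) = ⨂ₜ[F2] j, m j := by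
        rw [hH, hLeibniz, hLeibniz, map_sum, ← Finset.sum_add_distrib]
        rw [Finset.sum_eq_single i]
        · rw [hH, ← (Function.update_eq_self i m : _ = m)]
          simp only [Function.update_self, Function.update_idem]
          rw [← MultilinearMap.map_update_add, hh]
        · intro j _ hj
          rw [hH, Function.update_of_ne hj, Function.update_of_ne hj.symm,
            Function.update_comm hj]
          rw [← two_smul F2, show (2 : F2) = 0 from rfl, zero_smul]
        · simp
      simpa using this
    refine DualNumber.free_of_exact (K := F2) fun t ht ↦ ⟨H t, ?_⟩
    have : (ε : R) • H t + H ((ε : R) • t) = t := LinearMap.congr_fun hcontr t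
    simpa [ht] using this
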